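/- Let A ∈ ℂ^{M×N} with rows a₁ᴴ, …, a_Mᴴ, let b̄ ∈ ℝ^M with b̄_i ≥ 0, let y ∈ ℝ^M, let σ > 0, σ_k > 0, and C > 0. Define g_PG : ℝ^N → ℝ by g_PG(x) = Σ_{i=1}^M φ(|a_iᴴ x|² + b̄_i ; y_i). Let p : ℝ^N → ℝ be a smooth probability density that is not almost everywhere zero, and let p_{σ_k} = p ⋆ N(0, σ_k² I). Then the map x ↦ ∇g_PG(x) + ∇ log p_{σ_k}(x) is Lipschitz continuous on the cube [−C, C]^N; that is, there exists a finite constant L* such that ‖(∇g_PG(x) + ∇ log p_{σ_k}(x)) − (∇g_PG(z) + ∇ log p_{σ_k}(z))‖₂ ≤ L* ‖x − z‖₂ for all x, z ∈ [−C, C]^N. -/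

import Mathlib

open Real Set Finset MeasureTheory

/-- The Poisson–Gaussian likelihood series
`s(a, b) = Σ_{n=0}^∞ (aⁿ / n!) · exp(−(b − n)² / (2σ²))`. -/
noncomputable def pgS (σ a b : ℝ) : ℝ :=
  ∑' n : ℕ, a ^ n / (Nat.factorial n) * Real.exp (-(b - n) ^ 2 / (2 * σ ^ 2))

/-- `φ(u; v) = 1 − s(u, v − 1)/s(u, v)`. -/
noncomputable def pgPhi (σ u v : ℝ) : ℝ :=
  1 - pgS σ u (v - 1) / pgS σ u v

/-- The Poisson–Gaussian Wirtinger-flow cost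
`g_PG(x) = Σ_{i=1}^M φ(|a_iᴴ x|² + b̄_i ; y_i)`. -/
noncomputable def gPG (σ : ℝ) (M N : ℕ) (A : Matrix (Fin M) (Fin N) ℂ)
    (bbar y : Fin M → ℝ) (x : EuclideanSpace ℝ (Fin N)) : ℝ :=
  ∑ i, pgPhi σ (‖(∑ j, A i j * (x j : ℂ))‖ ^ 2 + bbar i) (y i)

/-- The Gaussian-smoothed density `p_σ = p ⋆ N(0, σ² I)` on `ℝ^N`. -/
noncomputable def gaussSmoothN (N : ℕ) (p : EuclideanSpace ℝ (Fin N) → ℝ) (σ : ℝ)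
    (x : EuclideanSpace ℝ (Fin N)) : ℝ :=
  ∫ t : EuclideanSpace ℝ (Fin N),
    p t * ((2 * π * σ ^ 2) ^ (-(N : ℝ) / 2) * Real.exp (-‖x - t‖ ^ 2 / (2 * σ ^ 2)))

/-- The coefficients of `pgS` as a power series in its first argument are dominated by those of the
exponential series, so `pgS` is smooth in that argument. -/
lemma contDiff_pgS (σ b : ℝ) {n : WithTop ℕ∞} : ContDiff ℝ n (fun a => pgS σ a b) := by
  set c : ℕ → ℝ := fun m => Real.exp (-(b - m) ^ 2 / (2 * σ ^ 2)) / (Nat.factorial m) with hc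
  have hle : ∀ m, ‖c m‖ ≤ 1 / (Nat.factorial m) := by
    intro m
    simp only [hc]
    rw [Real.norm_of_nonneg (by positivity)]
    gcongr
    refine Real.exp_le_one_iff.2 ?_
    rw [neg_div]
    exact neg_nonpos.2 (by positivity)
  have hrad : (FormalMultilinearSeries.ofScalars ℝ c).radius = ⊤ := by
    refine FormalMultilinearSeries.radius_eq_top_of_summable_norm _ fun r => ?_
    refine Summable.of_nonneg_of_le (fun m => by positivity) (fun m => ?_)
      (Real.summable_pow_div_factorial (r : ℝ))
    rw [FormalMultilinearSeries.ofScalars_norm, div_eq_mul_one_div, mul_comm]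
    exact mul_le_mul_of_nonneg_left (hle m) (by positivity)
  have hball := (FormalMultilinearSeries.ofScalars ℝ c).hasFPowerSeriesOnBall (by simp [hrad])
  have heq : (fun a => pgS σ a b) = (FormalMultilinearSeries.ofScalars ℝ c).sum := by
    funext a
    rw [pgS, FormalMultilinearSeries.sum]
    refine tsum_congr fun m => ?_
    rw [FormalMultilinearSeries.ofScalars_apply_eq, smul_eq_mul, hc]
    ring
  rw [heq]
  refine AnalyticOnNhd.contDiff fun a _ => hball.analyticAt_of_mem ?_
  simp [hrad]

lemma summable_pgS (σ a b : ℝ) :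
    Summable fun n : ℕ => a ^ n / (Nat.factorial n) * Real.exp (-(b - n) ^ 2 / (2 * σ ^ 2)) := by
  refine Summable.of_norm_bounded (Real.summable_pow_div_factorial |a|) fun n => ?_
  rw [norm_mul, norm_div, norm_pow, Real.norm_eq_abs, Real.norm_natCast,
    Real.norm_of_nonneg (Real.exp_nonneg _)]
  refine mul_le_of_le_one_right (by positivity) (Real.exp_le_one_iff.2 ?_)
  rw [neg_div]
  exact neg_nonpos.2 (by positivity)

lemma pgS_pos (σ b : ℝ) {a : ℝ} (ha : 0 ≤ a) : 0 < pgS σ a b :=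
  (summable_pgS σ a b).tsum_pos (fun n => by positivity) 0 (by simp [Real.exp_pos])

lemma contDiffAt_pgPhi (σ v : ℝ) {u : ℝ} (hu : 0 ≤ u) {n : WithTop ℕ∞} :
    ContDiffAt ℝ n (fun u => pgPhi σ u v) u :=
  contDiffAt_const.sub <| (contDiff_pgS σ (v - 1)).contDiffAt.div (contDiff_pgS σ v).contDiffAt
    (pgS_pos σ v hu).ne'

lemma contDiff_gPG (σ : ℝ) (M N : ℕ) (A : Matrix (Fin M) (Fin N) ℂ) (bbar y : Fin M → ℝ)
    (hbbar : ∀ i, 0 ≤ bbar i) {n : WithTop ℕ∞} : ContDiff ℝ n (gPG σ M N A bbar y) := by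
  unfold gPG
  refine ContDiff.sum fun i _ => contDiff_iff_contDiffAt.2 fun x => ?_
  have hu : ContDiff ℝ n fun x : EuclideanSpace ℝ (Fin N) =>
      ‖(∑ j, A i j * (x j : ℂ))‖ ^ 2 + bbar i := by
    refine (ContDiff.norm_sq ℝ (ContDiff.sum fun j _ => contDiff_const.mul ?_)).add contDiff_const
    exact Complex.ofRealCLM.contDiff.comp (EuclideanSpace.proj (𝕜 := ℝ) j).contDiff
  exact ContDiffAt.comp (g := fun u => pgPhi σ u (y i)) x
    (contDiffAt_pgPhi σ (y i) (add_nonneg (sq_nonneg _) (hbbar i))) hu.contDiffAt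

section Smoothing

variable {E F : Type*} [NormedAddCommGroup E] [MeasurableSpace E] [BorelSpace E]
  [SecondCountableTopology E] [NormedAddCommGroup F] [NormedSpace ℝ F] {μ : Measure E}
  {p : E → ℝ} {K : E → F}

lemma integrable_smul_comp_sub (hp : Integrable p μ) (hK : Continuous K) {B : ℝ}
    (hB : ∀ z, ‖K z‖ ≤ B) (x : E) : Integrable (fun t => p t • K (x - t)) μ :=
  hp.smul_bdd B (hK.comp (continuous_const.sub continuous_id)).aestronglyMeasurable
    (.of_forall fun t => hB (x - t))

lemma continuous_integral_smul_comp_sub (hp : Integrable p μ) (hK : Continuous K) {B : ℝ}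
    (hB : ∀ z, ‖K z‖ ≤ B) : Continuous fun x => ∫ t, p t • K (x - t) ∂μ := by
  refine continuous_of_dominated (bound := fun t => ‖p t‖ * B)
    (fun x => (integrable_smul_comp_sub hp hK hB x).aestronglyMeasurable)
    (fun x => .of_forall fun t => ?_) (hp.norm.mul_const B) (.of_forall fun t => by fun_prop)
  rw [norm_smul]
  gcongr
  exact hB _

variable [NormedSpace ℝ E]

lemma hasFDerivAt_integral_smul_comp_sub (hp : Integrable p μ) (hK : ContDiff ℝ 1 K) {B B' : ℝ}
    (hB : ∀ z, ‖K z‖ ≤ B) (hB' : ∀ z, ‖fderiv ℝ K z‖ ≤ B') (x : E) :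
    HasFDerivAt (fun x => ∫ t, p t • K (x - t) ∂μ) (∫ t, p t • fderiv ℝ K (x - t) ∂μ) x := by
  refine hasFDerivAt_integral_of_dominated_of_fderiv_le (bound := fun t => ‖p t‖ * B')
    (F' := fun x t => p t • fderiv ℝ K (x - t)) Filter.univ_mem
    (.of_forall fun x => (integrable_smul_comp_sub hp hK.continuous hB x).aestronglyMeasurable)
    (integrable_smul_comp_sub hp hK.continuous hB x)
    (integrable_smul_comp_sub hp (hK.continuous_fderiv one_ne_zero) hB' x).aestronglyMeasurable
    (.of_forall fun t z _ => ?_) (hp.norm.mul_const B') (.of_forall fun t z _ => ?_)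
  · rw [norm_smul]
    gcongr
    exact hB' _
  · have h := (hK.differentiable one_ne_zero (z - t)).hasFDerivAt.comp z
      ((hasFDerivAt_id z).sub_const t)
    exact h.const_smul (p t)

lemma contDiff_one_integral_smul_comp_sub (hp : Integrable p μ) (hK : ContDiff ℝ 1 K) {B B' : ℝ}
    (hB : ∀ z, ‖K z‖ ≤ B) (hB' : ∀ z, ‖fderiv ℝ K z‖ ≤ B') :
    ContDiff ℝ 1 fun x => ∫ t, p t • K (x - t) ∂μ :=
  contDiff_one_iff_hasFDerivAt.2 ⟨_,
    continuous_integral_smul_comp_sub hp (hK.continuous_fderiv one_ne_zero) hB',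
    hasFDerivAt_integral_smul_comp_sub hp hK hB hB'⟩

lemma contDiff_two_integral_smul_comp_sub (hp : Integrable p μ) (hK : ContDiff ℝ 2 K)
    {B B' B'' : ℝ} (hB : ∀ z, ‖K z‖ ≤ B) (hB' : ∀ z, ‖fderiv ℝ K z‖ ≤ B')
    (hB'' : ∀ z, ‖fderiv ℝ (fderiv ℝ K) z‖ ≤ B'') :
    ContDiff ℝ 2 fun x => ∫ t, p t • K (x - t) ∂μ :=
  (contDiff_succ_iff_hasFDerivAt (n := 1)).2 ⟨_,
    contDiff_one_integral_smul_comp_sub hp (hK.fderiv_right (by norm_num)) hB' hB'',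
    hasFDerivAt_integral_smul_comp_sub hp (hK.of_le (by norm_num)) hB hB'⟩

end Smoothing

section Gaussian

variable {E : Type*} [NormedAddCommGroup E] [InnerProductSpace ℝ E] (k : ℝ)

lemma contDiff_exp_neg_mul_norm_sq {n : WithTop ℕ∞} :
    ContDiff ℝ n fun z : E => Real.exp (-k * ‖z‖ ^ 2) :=
  (contDiff_const.mul (contDiff_norm_sq ℝ)).exp

lemma hasFDerivAt_exp_neg_mul_norm_sq (z : E) :
    HasFDerivAt (fun z : E => Real.exp (-k * ‖z‖ ^ 2))
      ((-(2 * k) * Real.exp (-k * ‖z‖ ^ 2)) • innerSL ℝ z) z := by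
  convert ((hasStrictFDerivAt_norm_sq z).hasFDerivAt.const_mul (-k)).exp using 1
  ext w
  simp
  ring

lemma fderiv_exp_neg_mul_norm_sq :
    fderiv ℝ (fun z : E => Real.exp (-k * ‖z‖ ^ 2)) =
      fun z => (-(2 * k) * Real.exp (-k * ‖z‖ ^ 2)) • innerSL ℝ z :=
  funext fun z => (hasFDerivAt_exp_neg_mul_norm_sq k z).fderiv

variable {k}

lemma mul_sq_mul_exp_neg_le_one (r : ℝ) : k * r ^ 2 * Real.exp (-k * r ^ 2) ≤ 1 := by
  have h := Real.add_one_le_exp (k * r ^ 2)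
  rw [neg_mul, Real.exp_neg, ← div_eq_mul_inv, div_le_one (Real.exp_pos _)]
  linarith

lemma exp_neg_mul_sq_le_one (hk : 0 ≤ k) (r : ℝ) : Real.exp (-k * r ^ 2) ≤ 1 := by
  rw [Real.exp_le_one_iff, neg_mul]
  exact neg_nonpos.2 (by positivity)

lemma norm_fderiv_exp_neg_mul_norm_sq_le (hk : 0 ≤ k) (z : E) :
    ‖fderiv ℝ (fun z : E => Real.exp (-k * ‖z‖ ^ 2)) z‖ ≤ 2 * k + 2 := by
  rw [fderiv_exp_neg_mul_norm_sq, norm_smul, innerSL_apply_norm, norm_mul, norm_neg,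
    Real.norm_of_nonneg (by positivity), Real.norm_of_nonneg (Real.exp_nonneg _)]
  have h1 := mul_sq_mul_exp_neg_le_one (k := k) ‖z‖
  have h2 := exp_neg_mul_sq_le_one hk ‖z‖
  have h3 : ‖z‖ ≤ 1 + ‖z‖ ^ 2 := by nlinarith [sq_nonneg (‖z‖ - 1)]
  calc 2 * k * Real.exp (-k * ‖z‖ ^ 2) * ‖z‖
      ≤ 2 * k * Real.exp (-k * ‖z‖ ^ 2) * (1 + ‖z‖ ^ 2) := by gcongr
    _ = 2 * k * Real.exp (-k * ‖z‖ ^ 2) + 2 * (k * ‖z‖ ^ 2 * Real.exp (-k * ‖z‖ ^ 2)) := by ring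
    _ ≤ 2 * k * 1 + 2 * 1 := by gcongr
    _ = 2 * k + 2 := by ring

lemma norm_fderiv_fderiv_exp_neg_mul_norm_sq_le (hk : 0 ≤ k) (z : E) :
    ‖fderiv ℝ (fderiv ℝ fun z : E => Real.exp (-k * ‖z‖ ^ 2)) z‖ ≤ 6 * k := by
  let L : E →L[ℝ] E →L[ℝ] ℝ := innerSL ℝ
  have hL : ‖L‖ ≤ 1 := norm_innerSL_le ℝ
  have hLz : ‖L z‖ = ‖z‖ := innerSL_apply_norm ℝ z
  have hd : HasFDerivAt (fun z : E => (-(2 * k) * Real.exp (-k * ‖z‖ ^ 2)) • L z)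
      ((-(2 * k) * Real.exp (-k * ‖z‖ ^ 2)) • L +
        (-(2 * k) • (-(2 * k) * Real.exp (-k * ‖z‖ ^ 2)) • L z).smulRight (L z)) z :=
    ((hasFDerivAt_exp_neg_mul_norm_sq k z).const_mul (-(2 * k))).smul L.hasFDerivAt
  rw [fderiv_exp_neg_mul_norm_sq]
  change ‖fderiv ℝ (fun z : E => (-(2 * k) * Real.exp (-k * ‖z‖ ^ 2)) • L z) z‖ ≤ 6 * k
  rw [hd.fderiv]
  have h1 := mul_sq_mul_exp_neg_le_one (k := k) ‖z‖
  have h2 := exp_neg_mul_sq_le_one hk ‖z‖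
  refine (ContinuousLinearMap.opNorm_add_le _ _).trans ?_
  rw [ContinuousLinearMap.norm_smulRight_apply, norm_smul, norm_smul, norm_smul,
    hLz, norm_mul, norm_neg, Real.norm_of_nonneg (by positivity : 0 ≤ 2 * k),
    Real.norm_of_nonneg (Real.exp_nonneg _)]
  calc 2 * k * Real.exp (-k * ‖z‖ ^ 2) * ‖L‖
        + 2 * k * (2 * k * Real.exp (-k * ‖z‖ ^ 2) * ‖z‖) * ‖z‖
      ≤ 2 * k * 1 * 1 + 4 * k * (k * ‖z‖ ^ 2 * Real.exp (-k * ‖z‖ ^ 2)) := by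
        refine add_le_add ?_ (le_of_eq (by ring))
        gcongr
    _ ≤ 2 * k * 1 * 1 + 4 * k * 1 := by gcongr
    _ = 6 * k := by ring

end Gaussian

lemma gaussSmoothN_eq (N : ℕ) (p : EuclideanSpace ℝ (Fin N) → ℝ) (σ : ℝ)
    (x : EuclideanSpace ℝ (Fin N)) :
    gaussSmoothN N p σ x = (2 * π * σ ^ 2) ^ (-(N : ℝ) / 2) *
      ∫ t, p t • Real.exp (-(1 / (2 * σ ^ 2)) * ‖x - t‖ ^ 2) := by
  rw [gaussSmoothN, ← integral_const_mul]
  refine integral_congr_ae (.of_forall fun t => ?_)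
  have h : -‖x - t‖ ^ 2 / (2 * σ ^ 2) = -(1 / (2 * σ ^ 2)) * ‖x - t‖ ^ 2 := by ring
  simp only [smul_eq_mul, h]
  ring

lemma contDiff_two_gaussSmoothN (N : ℕ) {p : EuclideanSpace ℝ (Fin N) → ℝ} (hp : Integrable p)
    (σ : ℝ) : ContDiff ℝ 2 (gaussSmoothN N p σ) := by
  have hk : 0 ≤ 1 / (2 * σ ^ 2) := by positivity
  rw [funext (gaussSmoothN_eq N p σ)]
  refine contDiff_const.mul (contDiff_two_integral_smul_comp_sub hp
    (contDiff_exp_neg_mul_norm_sq (1 / (2 * σ ^ 2))) (B := 1) (fun z => ?_)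
    (norm_fderiv_exp_neg_mul_norm_sq_le hk) (norm_fderiv_fderiv_exp_neg_mul_norm_sq_le hk))
  rw [Real.norm_of_nonneg (Real.exp_nonneg _)]
  exact exp_neg_mul_sq_le_one hk ‖z‖

lemma gaussSmoothN_pos (N : ℕ) {p : EuclideanSpace ℝ (Fin N) → ℝ} (hp : Integrable p)
    (hp_nonneg : ∀ x, 0 ≤ p x) (hp_ne : ¬ ∀ᵐ x, p x = 0) {σ : ℝ} (hσ : 0 < σ)
    (x : EuclideanSpace ℝ (Fin N)) : 0 < gaussSmoothN N p σ x := by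
  have hk : 0 ≤ 1 / (2 * σ ^ 2) := by positivity
  have hint : Integrable fun t => p t • Real.exp (-(1 / (2 * σ ^ 2)) * ‖x - t‖ ^ 2) :=
    integrable_smul_comp_sub hp (contDiff_exp_neg_mul_norm_sq (1 / (2 * σ ^ 2)) (n := 0)).continuous
      (B := 1) (fun z => by
        rw [Real.norm_of_nonneg (Real.exp_nonneg _)]
        exact exp_neg_mul_sq_le_one hk ‖z‖) x
  have hnonneg : ∀ t, 0 ≤ p t • Real.exp (-(1 / (2 * σ ^ 2)) * ‖x - t‖ ^ 2) := fun t =>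
    mul_nonneg (hp_nonneg t) (Real.exp_nonneg _)
  rw [gaussSmoothN_eq]
  refine mul_pos (by positivity) ((integral_nonneg hnonneg).lt_of_ne' fun h => hp_ne ?_)
  filter_upwards [(integral_eq_zero_iff_of_nonneg hnonneg hint).1 h] with t ht
  simpa [(Real.exp_pos _).ne'] using ht

lemma ContDiff.gradient {E : Type*} [NormedAddCommGroup E] [InnerProductSpace ℝ E]
    [CompleteSpace E] {f : E → ℝ} {m n : WithTop ℕ∞} (hf : ContDiff ℝ n f) (hmn : m + 1 ≤ n) :
    ContDiff ℝ m (gradient f) :=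
  (InnerProductSpace.toDual ℝ E).symm.toContinuousLinearEquiv.contDiff.comp (hf.fderiv_right hmn)

lemma isCompact_cube (N : ℕ) (C : ℝ) :
    IsCompact {x : EuclideanSpace ℝ (Fin N) | ∀ j, |x j| ≤ C} := by
  have h : {x : EuclideanSpace ℝ (Fin N) | ∀ j, |x j| ≤ C} =
      EuclideanSpace.equiv (Fin N) ℝ ⁻¹' Set.univ.pi fun _ => Set.Icc (-C) C := by
    ext x
    simp [abs_le, Pi.le_def, forall_and]
  rw [h]
  exact (EuclideanSpace.equiv (Fin N) ℝ).toHomeomorph.isCompact_preimage.2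
    (isCompact_univ_pi fun _ => isCompact_Icc)

/-- The map `x ↦ ∇g_PG(x) + ∇ log p_{σ_k}(x)` is Lipschitz continuous
on the cube `[−C, C]^N`. -/
theorem gPG_plus_score_lipschitz_on_cube (σ : ℝ) (hσ : 0 < σ)
    (σk : ℝ) (hσk : 0 < σk) (M N : ℕ) (A : Matrix (Fin M) (Fin N) ℂ)
    (bbar y : Fin M → ℝ) (hbbar : ∀ i, 0 ≤ bbar i)
    (C : ℝ) (hC : 0 < C)
    (p : EuclideanSpace ℝ (Fin N) → ℝ) (hp_smooth : ContDiff ℝ (⊤ : ℕ∞) p)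
    (hp_nonneg : ∀ x, 0 ≤ p x) (hp_int : Integrable p) (hp_one : ∫ x, p x = 1)
    (hp_ne : ¬ (∀ᵐ x : EuclideanSpace ℝ (Fin N), p x = 0)) :
    ∃ Lstar : ℝ, ∀ x z : EuclideanSpace ℝ (Fin N),
      (∀ j, |x j| ≤ C) → (∀ j, |z j| ≤ C) →
      ‖(gradient (gPG σ M N A bbar y) x +
          gradient (fun w => Real.log (gaussSmoothN N p σk w)) x) -
        (gradient (gPG σ M N A bbar y) z +
          gradient (fun w => Real.log (gaussSmoothN N p σk w)) z)‖ ≤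
        Lstar * ‖x - z‖ := by
  have hscore : ContDiff ℝ 2 fun w => Real.log (gaussSmoothN N p σk w) :=
    (contDiff_two_gaussSmoothN N hp_int σk).log fun w =>
      (gaussSmoothN_pos N hp_int hp_nonneg hp_ne hσk w).ne'
  have hsum : ContDiff ℝ 1 fun x => gradient (gPG σ M N A bbar y) x +
      gradient (fun w => Real.log (gaussSmoothN N p σk w)) x :=
    ((contDiff_gPG σ M N A bbar y hbbar (n := 2)).gradient (by norm_num)).add
      (hscore.gradient (by norm_num))
  obtain ⟨L, hL⟩ := LocallyLipschitzOn.exists_lipschitzOnWith_of_compact (isCompact_cube N C)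
    hsum.locallyLipschitz.locallyLipschitzOn
  exact ⟨L, fun x z hx hz => hL.norm_sub_le hx hz⟩
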